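/- (Power iteration convergence bound.) Let H be a real symmetric positive semidefinite n×n matrix with eigenvalues λ_1 ≥ λ_2 ≥ ⋯ ≥ λ_n ≥ 0 and λ_1 > λ_2, and let z_1 be a unit eigenvector for λ_1. Let v be a unit vector with c := ⟨v, z_1⟩ ≠ 0, and for m ≥ 1 let θ_m be the Rayleigh quotient of the m-th power-iteration vector H^{m−1} v (assumed nonzero): θ_m = ⟨H^{m−1}v, H(H^{m−1}v)⟩ / ⟨H^{m−1}v, H^{m−1}v⟩. Then λ_1 ≥ θ_m ≥ λ_1 − (λ_1 − λ_n) · tan²φ · (λ_2/λ_1)^{2(m−1)}, where cos φ = |c| (so tan²φ = (1 − c²)/c²). In particular, power iteration converges only at the geometric rate (λ_2/λ_1)^{2(m−1)}, which is far slower than the Chebyshev rate achieved by Lanczos over the same Krylov subspace. -/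

import Mathlib

open Matrix

theorem dotProduct_eq_sum_of_orthonormal {ι : Type*} [Fintype ι] [DecidableEq ι]
    {z : ι → ι → ℝ} (horth : ∀ i j, z i ⬝ᵥ z j = if i = j then (1 : ℝ) else 0)
    (x y : ι → ℝ) : x ⬝ᵥ y = ∑ i, (z i ⬝ᵥ x) * (z i ⬝ᵥ y) := by
  have hZ : Matrix.of z * (Matrix.of z)ᵀ = 1 := by
    ext i j
    rw [Matrix.one_apply, ← horth i j]
    rfl
  have hZ' : (Matrix.of z)ᵀ * Matrix.of z = 1 := mul_eq_one_comm.mp hZ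
  calc x ⬝ᵥ y = x ⬝ᵥ ((Matrix.of z)ᵀ * Matrix.of z) *ᵥ y := by rw [hZ', one_mulVec]
    _ = (Matrix.of z *ᵥ x) ⬝ᵥ (Matrix.of z *ᵥ y) := by
      rw [← mulVec_mulVec, dotProduct_mulVec, vecMul_transpose]
    _ = ∑ i, (z i ⬝ᵥ x) * (z i ⬝ᵥ y) := rfl

theorem dotProduct_mulVec_of_eigenvector {ι : Type*} [Fintype ι] {H : Matrix ι ι ℝ}
    (hH : H.IsSymm) {u : ι → ℝ} {μ : ℝ} (hu : H *ᵥ u = μ • u) (x : ι → ℝ) :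
    u ⬝ᵥ H *ᵥ x = μ * (u ⬝ᵥ x) := by
  rw [dotProduct_mulVec, ← mulVec_transpose, hH.eq, hu, smul_dotProduct, smul_eq_mul]

theorem dotProduct_pow_mulVec_of_eigenvector {ι : Type*} [Fintype ι] [DecidableEq ι]
    {H : Matrix ι ι ℝ} (hH : H.IsSymm) {u : ι → ℝ} {μ : ℝ} (hu : H *ᵥ u = μ • u)
    (x : ι → ℝ) (k : ℕ) : u ⬝ᵥ (H ^ k) *ᵥ x = μ ^ k * (u ⬝ᵥ x) := by
  induction k with
  | zero => simp
  | succ k ih =>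
    rw [pow_succ', ← mulVec_mulVec, dotProduct_mulVec_of_eigenvector hH hu, ih]
    ring

/-- Power iteration convergence bound.  Let `H` be real symmetric positive
semidefinite `n×n` with eigenvalues `λ_1 ≥ ⋯ ≥ λ_n ≥ 0` (given with an orthonormal
eigenbasis `z`) and `λ_1 > λ_2`.  Let `v` be a unit seed with `c = ⟨v, z_1⟩ ≠ 0`, and
let `θ_m` be the Rayleigh quotient of the `m`-th power-iteration vector
`H^{m−1} v` (assumed nonzero).  Then
`λ_1 ≥ θ_m ≥ λ_1 − (λ_1 − λ_n)·tan²φ·(λ_2/λ_1)^{2(m−1)}`, with `tan²φ = (1 − c²)/c²`. -/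
theorem power_iteration_bound
    {n : ℕ} (hn : 1 < n) (H : Matrix (Fin n) (Fin n) ℝ) (hH : H.IsSymm)
    (lam : Fin n → ℝ) (z : Fin n → (Fin n → ℝ))
    (heig : ∀ i, H.mulVec (z i) = lam i • z i)
    (horth : ∀ i j, z i ⬝ᵥ z j = if i = j then (1 : ℝ) else 0)
    (hmono : ∀ i j : Fin n, i ≤ j → lam j ≤ lam i)
    (hpsd : ∀ i, 0 ≤ lam i)
    (h12 : lam ⟨1, hn⟩ < lam ⟨0, by omega⟩)
    (v : Fin n → ℝ) (hv : v ⬝ᵥ v = 1)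
    (c : ℝ) (hc : c = v ⬝ᵥ z ⟨0, by omega⟩) (hc0 : c ≠ 0)
    (m : ℕ) (hm : 1 ≤ m)
    (hw : (H ^ (m - 1)).mulVec v ≠ 0)
    (θₘ : ℝ)
    (hθ : θₘ = ((H ^ (m - 1)).mulVec v ⬝ᵥ H.mulVec ((H ^ (m - 1)).mulVec v)) /
        ((H ^ (m - 1)).mulVec v ⬝ᵥ (H ^ (m - 1)).mulVec v)) :
    θₘ ≤ lam ⟨0, by omega⟩ ∧
      lam ⟨0, by omega⟩ -
          (lam ⟨0, by omega⟩ - lam ⟨n - 1, by omega⟩) * ((1 - c ^ 2) / c ^ 2) *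
            (lam ⟨1, hn⟩ / lam ⟨0, by omega⟩) ^ (2 * (m - 1)) ≤ θₘ := by
  obtain ⟨k, hk⟩ : ∃ k, k = m - 1 := ⟨_, rfl⟩
  rw [← hk] at hw hθ ⊢
  set i₀ : Fin n := ⟨0, by omega⟩
  set i₁ : Fin n := ⟨1, hn⟩
  set iₙ : Fin n := ⟨n - 1, by omega⟩
  set w := (H ^ k) *ᵥ v
  set a : Fin n → ℝ := fun i => z i ⬝ᵥ v
  have hac : a i₀ = c := by rw [hc, dotProduct_comm]
  have hcoord (i : Fin n) : z i ⬝ᵥ w = lam i ^ k * a i :=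
    dotProduct_pow_mulVec_of_eigenvector hH (heig i) v k
  have hden : w ⬝ᵥ w = ∑ i, lam i ^ (2 * k) * a i ^ 2 := by
    rw [dotProduct_eq_sum_of_orthonormal horth]
    refine Finset.sum_congr rfl fun i _ => ?_
    rw [hcoord]
    ring
  have hgap : lam i₀ * (w ⬝ᵥ w) - w ⬝ᵥ H *ᵥ w =
      ∑ i, (lam i₀ - lam i) * (lam i ^ (2 * k) * a i ^ 2) := by
    rw [hden, dotProduct_eq_sum_of_orthonormal horth w, Finset.mul_sum,
      ← Finset.sum_sub_distrib]
    refine Finset.sum_congr rfl fun i _ => ?_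
    rw [dotProduct_mulVec_of_eigenvector hH (heig i), hcoord]
    ring
  have htop (i : Fin n) : lam i ≤ lam i₀ := hmono _ _ (Fin.mk_le_of_le_val (Nat.zero_le _))
  have hbot (i : Fin n) : lam iₙ ≤ lam i :=
    hmono _ _ (Fin.le_def.mpr (Nat.le_sub_one_of_lt i.isLt))
  have hsecond (i : Fin n) (hi : i ≠ i₀) : lam i ≤ lam i₁ := by
    refine hmono _ _ (Fin.le_def.mpr (Nat.one_le_iff_ne_zero.mpr fun h => hi ?_))
    exact Fin.ext h
  have hpos : 0 < lam i₀ := (hpsd i₁).trans_lt h12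
  have hweight (i : Fin n) : 0 ≤ lam i ^ (2 * k) * a i ^ 2 :=
    mul_nonneg (pow_nonneg (hpsd i) _) (sq_nonneg _)
  have hlead : 0 < lam i₀ ^ (2 * k) * c ^ 2 := by positivity
  have hden_ge : lam i₀ ^ (2 * k) * c ^ 2 ≤ w ⬝ᵥ w := by
    rw [hden, ← hac]
    exact Finset.single_le_sum (f := fun i => lam i ^ (2 * k) * a i ^ 2)
      (fun i _ => hweight i) (Finset.mem_univ i₀)
  have hden_pos : 0 < w ⬝ᵥ w := hlead.trans_le hden_ge
  have hgap_nonneg : 0 ≤ lam i₀ * (w ⬝ᵥ w) - w ⬝ᵥ H *ᵥ w := by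
    rw [hgap]
    exact Finset.sum_nonneg fun i _ => mul_nonneg (sub_nonneg.mpr (htop i)) (hweight i)
  have htail : ∑ i ∈ Finset.univ.erase i₀, a i ^ 2 = 1 - c ^ 2 := by
    have hsum : ∑ i, a i ^ 2 = 1 := by
      rw [← hv, dotProduct_eq_sum_of_orthonormal horth]
      exact Finset.sum_congr rfl fun i _ => sq _
    rw [← Finset.add_sum_erase _ _ (Finset.mem_univ i₀), hac] at hsum
    linarith
  have hgap_le : lam i₀ * (w ⬝ᵥ w) - w ⬝ᵥ H *ᵥ w ≤
      (lam i₀ - lam iₙ) * lam i₁ ^ (2 * k) * (1 - c ^ 2) := by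
    rw [hgap, ← Finset.add_sum_erase _ _ (Finset.mem_univ i₀), sub_self, zero_mul, zero_add,
      ← htail, Finset.mul_sum]
    refine Finset.sum_le_sum fun i hi => ?_
    rw [mul_assoc]
    have hpow := pow_le_pow_left₀ (hpsd i) (hsecond i (Finset.ne_of_mem_erase hi)) (2 * k)
    exact mul_le_mul (sub_le_sub_left (hbot i) _)
      (mul_le_mul_of_nonneg_right hpow (sq_nonneg _)) (hweight i) (sub_nonneg.mpr (htop iₙ))
  have hdiff : lam i₀ - θₘ = (lam i₀ * (w ⬝ᵥ w) - w ⬝ᵥ H *ᵥ w) / (w ⬝ᵥ w) := by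
    rw [hθ, sub_div, mul_div_cancel_right₀ _ hden_pos.ne']
  constructor
  · rw [← sub_nonneg, hdiff]
    exact div_nonneg hgap_nonneg hden_pos.le
  · have hbound := div_le_div₀ (hgap_nonneg.trans hgap_le) hgap_le hlead hden_ge
    rw [← hdiff] at hbound
    have hrate : (lam i₀ - lam iₙ) * lam i₁ ^ (2 * k) * (1 - c ^ 2) /
        (lam i₀ ^ (2 * k) * c ^ 2) =
        (lam i₀ - lam iₙ) * ((1 - c ^ 2) / c ^ 2) * (lam i₁ / lam i₀) ^ (2 * k) := by
      rw [div_pow]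
      field_simp
    linarith
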